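/- Let M > 0, D(r) = 1 − 2M/r, A(r) = −(M/(2r³))·D(r), u₁ < u₂, v* ∈ ℝ, and let r be the Schwarzschild area-radius function on the strip S = [u₁,u₂] × [v*, ∞) (C¹, values in (2M,∞), ∂_v r = D(r)/2, ∂_u r = −D(r)/2). Let φ : S → ℝ be C² with ∂_u ∂_v φ = A(r)·φ, suppose sup_S r³·|∂_v φ| < ∞, and suppose that the limits lim_{v→∞} r³ ∂_v φ(uᵢ, v) exist for i = 1, 2. Set ψ = φ/r and define, for i = 1, 2, G_i = lim_{V→∞} ( ∫_{v*}^{V} r² ∂_v ψ (u_i, v) dv + ( r²ψ − (2/M)·r³ ∂_v φ )(u_i, V) ). Then both limits G₁, G₂ exist and G₂ − G₁ = ∫_{u₁}^{u₂} r² ∂_u ψ (u, v*) du. -/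

import Mathlib

open Filter Set

open MeasureTheory Topology

/-- Fundamental theorem of calculus on `[a, b]` with one-sided derivatives at the endpoints. -/
lemma integral_eq_sub_of_hasDerivWithinAt_Icc {f f' : ℝ → ℝ} {a b : ℝ} (hab : a ≤ b)
    (hf : ∀ x ∈ Icc a b, HasDerivWithinAt f (f' x) (Icc a b) x)
    (hf' : ContinuousOn f' (Icc a b)) : ∫ x in a..b, f' x = f b - f a :=
  intervalIntegral.integral_eq_sub_of_hasDerivAt_of_le hab
    (fun x hx => (hf x hx).continuousWithinAt)
    (fun x hx => (hf x (Ioo_subset_Icc_self hx)).hasDerivAt (Icc_mem_nhds hx.1 hx.2))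
    (hf'.intervalIntegrable_of_Icc hab)

/-- If `∂₁ P = K = ∂₂ Q` on a rectangle, with `K` continuous, then the boundary integrals of `P`
and `Q` agree. -/
lemma integral_boundary_eq_of_hasDerivWithinAt {P Q K : ℝ × ℝ → ℝ} {a b c d : ℝ}
    (hab : a ≤ b) (hcd : c ≤ d) (hK : ContinuousOn K (Icc a b ×ˢ Icc c d))
    (hP : ∀ p ∈ Icc a b ×ˢ Icc c d,
      HasDerivWithinAt (fun x => P (x, p.2)) (K p) (Icc a b) p.1)
    (hQ : ∀ p ∈ Icc a b ×ˢ Icc c d,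
      HasDerivWithinAt (fun y => Q (p.1, y)) (K p) (Icc c d) p.2) :
    ∫ y in c..d, (P (b, y) - P (a, y)) = ∫ x in a..b, (Q (x, d) - Q (x, c)) := by
  have hKint : IntegrableOn (Function.uncurry fun x y => K (x, y)) (uIoc a b ×ˢ uIoc c d) := by
    have := hK.integrableOn_compact (μ := volume) (isCompact_Icc.prod isCompact_Icc)
    rw [uIoc_of_le hab, uIoc_of_le hcd]
    exact this.mono_set (prod_mono Ioc_subset_Icc_self Ioc_subset_Icc_self)
  calc ∫ y in c..d, (P (b, y) - P (a, y))
      = ∫ y in c..d, ∫ x in a..b, K (x, y) := by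
        refine intervalIntegral.integral_congr fun y hy => ?_
        rw [uIcc_of_le hcd] at hy
        exact (integral_eq_sub_of_hasDerivWithinAt_Icc (f := fun x => P (x, y)) hab
          (fun x hx => hP (x, y) ⟨hx, hy⟩)
          (hK.comp (by fun_prop) fun x hx => ⟨hx, hy⟩)).symm
    _ = ∫ x in a..b, ∫ y in c..d, K (x, y) :=
        (intervalIntegral_intervalIntegral_swap hKint).symm
    _ = ∫ x in a..b, (Q (x, d) - Q (x, c)) := by
        refine intervalIntegral.integral_congr fun x hx => ?_
        rw [uIcc_of_le hab] at hx
        exact integral_eq_sub_of_hasDerivWithinAt_Icc (f := fun y => Q (x, y)) hcd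
          (fun y hy => hQ (x, y) ⟨hx, hy⟩)
          (hK.comp (by fun_prop) fun y hy => ⟨hx, hy⟩)

section OutgoingCone

variable {M c : ℝ} {R : ℝ → ℝ}

/-- The area radius tends to infinity along an outgoing null cone. -/
lemma tendsto_areaRadius_atTop (hM : 0 < M) (hR : ∀ v ∈ Ici c, 2 * M < R v)
    (hRd : ∀ v ∈ Ici c, HasDerivWithinAt R ((1 - 2 * M / R v) / 2) (Ici c) v) :
    Tendsto R atTop atTop := by
  have hcont : ContinuousOn R (Ici c) := fun v hv => (hRd v hv).continuousWithinAt
  have hD : ∀ v ∈ Ici c, 0 < 1 - 2 * M / R v := fun v hv => by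
    have := hR v hv
    rw [sub_pos, div_lt_one (by linarith)]
    exact this
  have hmono : MonotoneOn R (Ici c) :=
    monotoneOn_of_hasDerivWithinAt_nonneg (convex_Ici c) hcont
      (fun v hv => (hRd v (interior_subset hv)).mono interior_subset)
      fun v hv => by linarith [hD v (interior_subset hv)]
  set k : ℝ := (1 - 2 * M / R c) / 2 with hk
  have hk0 : 0 < k := by linarith [hD c self_mem_Ici]
  have hlin : MonotoneOn (fun v => R v - k * v) (Ici c) := by
    refine monotoneOn_of_hasDerivWithinAt_nonneg
      (f' := fun v => (1 - 2 * M / R v) / 2 - k * 1) (convex_Ici c)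
      (hcont.sub (by fun_prop))
      (fun v hv => ((hRd v (interior_subset hv)).mono interior_subset).sub
        ((hasDerivWithinAt_id v _).const_mul k)) fun v hv => ?_
    have hv' := interior_subset hv
    have h1 := hmono self_mem_Ici hv' hv'
    have h0 := hR c self_mem_Ici
    have : 2 * M / R v ≤ 2 * M / R c :=
      div_le_div_of_nonneg_left (by linarith) (by linarith) h1
    rw [hk]
    linarith
  refine tendsto_atTop_mono' atTop (f₁ := fun v => k * v + (R c - k * c)) ?_
    (tendsto_atTop_add_const_right _ _ (tendsto_id.const_mul_atTop hk0))
  filter_upwards [eventually_ge_atTop c] with v hv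
  have := hlin self_mem_Ici hv hv
  simp only at this
  linarith

/-- If `r³ ∂ᵥφ` is bounded along an outgoing null cone, then `r ∂ᵥφ` is integrable there. -/
lemma integrableOn_areaRadius_mul (hM : 0 < M) (hR : ∀ v ∈ Ici c, 2 * M < R v)
    (hRd : ∀ v ∈ Ici c, HasDerivWithinAt R ((1 - 2 * M / R v) / 2) (Ici c) v)
    {f' : ℝ → ℝ} (hf' : ContinuousOn f' (Ici c)) {C : ℝ}
    (hbd : ∀ v ∈ Ici c, R v ^ 3 * |f' v| ≤ C) :
    IntegrableOn (fun v => R v * f' v) (Ioi c) := by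
  have hcont : ContinuousOn R (Ici c) := fun v hv => (hRd v hv).continuousWithinAt
  have hpos : ∀ v ∈ Ici c, 0 < R v := fun v hv => by linarith [hR v hv]
  have hD : ∀ v ∈ Ici c, 0 < 1 - 2 * M / R v := fun v hv => by
    rw [sub_pos, div_lt_one (hpos v hv)]
    exact hR v hv
  have hmono : MonotoneOn R (Ici c) :=
    monotoneOn_of_hasDerivWithinAt_nonneg (convex_Ici c) hcont
      (fun v hv => (hRd v (interior_subset hv)).mono interior_subset)
      fun v hv => by linarith [hD v (interior_subset hv)]
  have hinv : ∀ v ∈ Ici c, HasDerivWithinAt (fun v => -(R v)⁻¹)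
      ((1 - 2 * M / R v) / 2 / R v ^ 2) (Ici c) v := fun v hv => by
    refine ((hRd v hv).inv (hpos v hv).ne').neg.congr_deriv ?_
    ring
  have hint : IntegrableOn (fun v => (1 - 2 * M / R v) / 2 / R v ^ 2) (Ioi c) := by
    refine integrableOn_Ioi_deriv_of_nonneg (g := fun v => -(R v)⁻¹) (l := -0)
      (hinv c self_mem_Ici).continuousWithinAt
      (fun v hv => (hinv v (Ioi_subset_Ici_self hv)).hasDerivAt (Ici_mem_nhds hv))
      (fun v hv => ?_) (tendsto_areaRadius_atTop hM hR hRd).inv_tendsto_atTop.neg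
    have := hD v (Ioi_subset_Ici_self hv)
    positivity
  set k : ℝ := (1 - 2 * M / R c) / 2 with hk
  have hk0 : 0 < k := by linarith [hD c self_mem_Ici]
  refine (hint.const_mul (C / k)).mono' ((hcont.mul hf').mono Ioi_subset_Ici_self
    |>.aestronglyMeasurable measurableSet_Ioi) ?_
  filter_upwards [ae_restrict_mem measurableSet_Ioi] with v hv
  have hv' := Ioi_subset_Ici_self hv
  have hr := hpos v hv'
  have hkv : k ≤ (1 - 2 * M / R v) / 2 := by
    have : 2 * M / R v ≤ 2 * M / R c :=
      div_le_div_of_nonneg_left (by linarith) (hpos c self_mem_Ici) (hmono self_mem_Ici hv' hv')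
    rw [hk]
    linarith
  have hb := hbd v hv'
  have hC : 0 ≤ C := le_trans (by positivity) hb
  calc ‖R v * f' v‖ = R v ^ 3 * |f' v| / R v ^ 2 := by
        rw [Real.norm_eq_abs, abs_mul, abs_of_pos hr]
        field_simp
    _ ≤ C / R v ^ 2 := by gcongr
    _ = C / k * (k / R v ^ 2) := by field_simp
    _ ≤ C / k * ((1 - 2 * M / R v) / 2 / R v ^ 2) := by gcongr

/-- Integration by parts for the gradient flux `∫ r² ∂ᵥ(φ / r) dv`. -/
lemma gradientFlux_add_boundary_eq (hM : 0 < M) (hR : ∀ v ∈ Ici c, 2 * M < R v)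
    (hRd : ∀ v ∈ Ici c, HasDerivWithinAt R ((1 - 2 * M / R v) / 2) (Ici c) v)
    {f f' : ℝ → ℝ} (hf : ∀ v ∈ Ici c, HasDerivWithinAt f (f' v) (Ici c) v)
    (hf' : ContinuousOn f' (Ici c)) {V : ℝ} (hV : c ≤ V) :
    (∫ v in c..V, R v ^ 2 * (f' v / R v - f v * (1 - 2 * M / R v) / (2 * R v ^ 2)))
        + R V ^ 2 * (f V / R V)
      = R c * f c + 2 * ∫ v in c..V, R v * f' v := by
  have hsub : Icc c V ⊆ Ici c := Icc_subset_Ici_self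
  have hpos : ∀ v ∈ Ici c, 0 < R v := fun v hv => by linarith [hR v hv]
  have hRc : ContinuousOn R (Icc c V) := fun v hv => ((hRd v (hsub hv)).mono hsub).continuousWithinAt
  have hfc : ContinuousOn f (Icc c V) := fun v hv => ((hf v (hsub hv)).mono hsub).continuousWithinAt
  have hf'c := hf'.mono hsub
  have hne : ∀ v ∈ Icc c V, R v ≠ 0 := fun v hv => (hpos v (hsub hv)).ne'
  have hprod : ∫ v in c..V, ((1 - 2 * M / R v) / 2 * f v + R v * f' v) = R V * f V - R c * f c :=
    integral_eq_sub_of_hasDerivWithinAt_Icc (f := fun v => R v * f v) hV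
      (fun v hv => ((hRd v (hsub hv)).mono hsub).mul ((hf v (hsub hv)).mono hsub))
      (by fun_prop (disch := assumption))
  have hsplit : ∫ v in c..V, R v ^ 2 * (f' v / R v - f v * (1 - 2 * M / R v) / (2 * R v ^ 2))
      = ∫ v in c..V, (2 * (R v * f' v) - ((1 - 2 * M / R v) / 2 * f v + R v * f' v)) := by
    refine intervalIntegral.integral_congr fun v hv => ?_
    rw [uIcc_of_le hV] at hv
    have := hne v hv
    field_simp
    ring
  rw [hsplit, intervalIntegral.integral_sub
      (ContinuousOn.intervalIntegrable_of_Icc hV (by fun_prop))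
      (ContinuousOn.intervalIntegrable_of_Icc hV (by fun_prop (disch := assumption))),
    intervalIntegral.integral_const_mul, hprod]
  have := hne V (right_mem_Icc.2 hV)
  field_simp
  ring

end OutgoingCone

/-- Conservation law for the modified gradient fluxes, reduced
truncated-null-foliation form (Theorem 1.2 of the paper, per solid angle): the
modified fluxes `G₁`, `G₂` through the two truncated outgoing cones exist and
`G₂ − G₁ = ∫_{u₁}^{u₂} r² ∂_u ψ (·, v*) du`. -/
theorem conservation_law_modified_gradient_fluxes
    (M : ℝ) (hM : 0 < M)
    (D A : ℝ → ℝ)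
    (hD : ∀ ρ : ℝ, D ρ = 1 - 2 * M / ρ)
    (hA : ∀ ρ : ℝ, A ρ = -(M / (2 * ρ ^ 3)) * D ρ)
    (u₁ u₂ vs : ℝ) (hu : u₁ < u₂)
    (S : Set (ℝ × ℝ)) (hS : S = Set.Icc u₁ u₂ ×ˢ Set.Ici vs)
    (r φ φu φv : ℝ × ℝ → ℝ)
    (hrcont : ContinuousOn r S)
    (hr : ∀ p ∈ S, 2 * M < r p)
    (hru : ∀ p ∈ S, HasDerivWithinAt (fun u => r (u, p.2)) (-(D (r p)) / 2) (Set.Icc u₁ u₂) p.1)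
    (hrv : ∀ p ∈ S, HasDerivWithinAt (fun v => r (p.1, v)) (D (r p) / 2) (Set.Ici vs) p.2)
    (hφC2 : ContDiffOn ℝ 2 φ S)
    (hφcont : ContinuousOn φ S) (hφucont : ContinuousOn φu S) (hφvcont : ContinuousOn φv S)
    (hφu : ∀ p ∈ S, HasDerivWithinAt (fun u => φ (u, p.2)) (φu p) (Set.Icc u₁ u₂) p.1)
    (hφv : ∀ p ∈ S, HasDerivWithinAt (fun v => φ (p.1, v)) (φv p) (Set.Ici vs) p.2)
    (hwave : ∀ p ∈ S, HasDerivWithinAt (fun u => φv (u, p.2)) (A (r p) * φ p) (Set.Icc u₁ u₂) p.1)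
    (C : ℝ) (hbd : ∀ p ∈ S, (r p) ^ 3 * |φv p| ≤ C)
    (L₁ L₂ : ℝ)
    (hL₁ : Tendsto (fun v => (r (u₁, v)) ^ 3 * φv (u₁, v)) atTop (nhds L₁))
    (hL₂ : Tendsto (fun v => (r (u₂, v)) ^ 3 * φv (u₂, v)) atTop (nhds L₂))
    (ψ ψu ψv : ℝ × ℝ → ℝ)
    (hψ : ψ = fun p => φ p / r p)
    (hψu : ψu = fun p => φu p / r p + φ p * D (r p) / (2 * (r p) ^ 2))
    (hψv : ψv = fun p => φv p / r p - φ p * D (r p) / (2 * (r p) ^ 2)) :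
    ∃ G₁ G₂ : ℝ,
      Tendsto (fun V => (∫ v in vs..V, (r (u₁, v)) ^ 2 * ψv (u₁, v))
          + ((r (u₁, V)) ^ 2 * ψ (u₁, V) - (2 / M) * (r (u₁, V)) ^ 3 * φv (u₁, V)))
        atTop (nhds G₁) ∧
      Tendsto (fun V => (∫ v in vs..V, (r (u₂, v)) ^ 2 * ψv (u₂, v))
          + ((r (u₂, V)) ^ 2 * ψ (u₂, V) - (2 / M) * (r (u₂, V)) ^ 3 * φv (u₂, V)))
        atTop (nhds G₂) ∧
      G₂ - G₁ = ∫ u in u₁..u₂, (r (u, vs)) ^ 2 * ψu (u, vs) := by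
  obtain rfl : D = fun ρ => 1 - 2 * M / ρ := funext hD
  obtain rfl : A = fun ρ => -(M / (2 * ρ ^ 3)) * (1 - 2 * M / ρ) := funext hA
  subst hS hψ hψu hψv
  simp only at hru hrv hwave ⊢
  have hpos : ∀ p ∈ Icc u₁ u₂ ×ˢ Ici vs, 0 < r p := fun p hp => by linarith [hr p hp]
  have hne : ∀ p ∈ Icc u₁ u₂ ×ˢ Ici vs, r p ≠ 0 := fun p hp => (hpos p hp).ne'
  have hmem : ∀ u ∈ Icc u₁ u₂, ∀ v ∈ Ici vs, (u, v) ∈ Icc u₁ u₂ ×ˢ Ici vs :=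
    fun u hu v hv => ⟨hu, hv⟩
  have hu₁ : u₁ ∈ Icc u₁ u₂ := left_mem_Icc.2 hu.le
  have hu₂ : u₂ ∈ Icc u₁ u₂ := right_mem_Icc.2 hu.le
  have hcone : ∀ u ∈ Icc u₁ u₂, ∀ {h : ℝ × ℝ → ℝ},
      ContinuousOn h (Icc u₁ u₂ ×ˢ Ici vs) → ContinuousOn (fun v => h (u, v)) (Ici vs) :=
    fun u hu h hh => hh.comp (by fun_prop) fun v hv => hmem u hu v hv
  have hflux : ∀ u ∈ Icc u₁ u₂, ∀ V, vs ≤ V →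
      (∫ v in vs..V, r (u, v) ^ 2 *
          (φv (u, v) / r (u, v) - φ (u, v) * (1 - 2 * M / r (u, v)) / (2 * r (u, v) ^ 2)))
        + (r (u, V) ^ 2 * (φ (u, V) / r (u, V)) - 2 / M * r (u, V) ^ 3 * φv (u, V))
      = r (u, vs) * φ (u, vs) + 2 * (∫ v in vs..V, r (u, v) * φv (u, v))
        - 2 / M * (r (u, V) ^ 3 * φv (u, V)) := by
    intro u hu V hV
    rw [← gradientFlux_add_boundary_eq (R := fun v => r (u, v)) (f := fun v => φ (u, v))
      (f' := fun v => φv (u, v)) hM (fun v hv => hr _ (hmem u hu v hv))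
      (fun v hv => hrv _ (hmem u hu v hv)) (fun v hv => hφv _ (hmem u hu v hv))
      (hcone u hu hφvcont) hV]
    ring
  have hlim : ∀ u ∈ Icc u₁ u₂, ∀ L,
      Tendsto (fun v => r (u, v) ^ 3 * φv (u, v)) atTop (𝓝 L) →
      ∃ G, Tendsto (fun V => (∫ v in vs..V, r (u, v) ^ 2 *
          (φv (u, v) / r (u, v) - φ (u, v) * (1 - 2 * M / r (u, v)) / (2 * r (u, v) ^ 2)))
        + (r (u, V) ^ 2 * (φ (u, V) / r (u, V)) - 2 / M * r (u, V) ^ 3 * φv (u, V)))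
        atTop (𝓝 G) := by
    intro u hu L hL
    have hint := integrableOn_areaRadius_mul (R := fun v => r (u, v))
      (f' := fun v => φv (u, v)) hM (fun v hv => hr _ (hmem u hu v hv))
      (fun v hv => hrv _ (hmem u hu v hv)) (hcone u hu hφvcont)
      (fun v hv => hbd _ (hmem u hu v hv))
    refine ⟨_, Tendsto.congr' ?_ ((((intervalIntegral_tendsto_integral_Ioi vs hint
      tendsto_id).const_mul 2).const_add (r (u, vs) * φ (u, vs))).sub (hL.const_mul (2 / M)))⟩
    filter_upwards [eventually_ge_atTop vs] with V hV
    exact (hflux u hu V hV).symm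
  obtain ⟨G₁, hG₁⟩ := hlim u₁ hu₁ L₁ hL₁
  obtain ⟨G₂, hG₂⟩ := hlim u₂ hu₂ L₂ hL₂
  refine ⟨G₁, G₂, hG₁, hG₂, ?_⟩
  have hbalance : ∀ V, vs ≤ V →
      ((r (u₂, vs) * φ (u₂, vs) + 2 * (∫ v in vs..V, r (u₂, v) * φv (u₂, v))
          - 2 / M * (r (u₂, V) ^ 3 * φv (u₂, V)))
        - (r (u₁, vs) * φ (u₁, vs) + 2 * (∫ v in vs..V, r (u₁, v) * φv (u₁, v))
          - 2 / M * (r (u₁, V) ^ 3 * φv (u₁, V))))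
      = (∫ u in u₁..u₂, r (u, vs) ^ 2 *
          (φu (u, vs) / r (u, vs) + φ (u, vs) * (1 - 2 * M / r (u, vs)) / (2 * r (u, vs) ^ 2)))
        + ∫ u in u₁..u₂, 3 / M * (1 - 2 * M / r (u, V)) * r (u, V) ^ 2 * φv (u, V) := by
    intro V hV
    have hvs : vs ∈ Ici vs := self_mem_Ici
    have hVm : V ∈ Ici vs := hV
    have hrect : Icc u₁ u₂ ×ˢ Icc vs V ⊆ Icc u₁ u₂ ×ˢ Ici vs :=
      prod_mono subset_rfl Icc_subset_Ici_self
    have hswap := integral_boundary_eq_of_hasDerivWithinAt (a := u₁) (b := u₂) (c := vs) (d := V)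
      (P := fun p => r p * φv p) (Q := fun p => -(1 - 2 * M / r p) / 2 * φ p)
      (K := fun p => -(1 - 2 * M / r p) / 2 * φv p
        + r p * (-(M / (2 * r p ^ 3)) * (1 - 2 * M / r p) * φ p)) hu.le hV
      (by
        refine ContinuousOn.mono ?_ hrect
        have h2 : ∀ p ∈ Icc u₁ u₂ ×ˢ Ici vs, 2 * r p ^ 3 ≠ 0 := fun p hp => by
          have := hpos p hp
          positivity
        fun_prop (disch := assumption))
      (fun p hp => (hru p (hrect hp)).mul (hwave p (hrect hp)))
      (fun p hp => by
        have hp' := hrect hp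
        have hp0 := hne p hp'
        have h1 := (hrv p hp').mono (t := Ici vs) subset_rfl
        have hd : HasDerivWithinAt (fun v => -(1 - 2 * M * (r (p.1, v))⁻¹) / 2 * φ (p.1, v))
            (- -(2 * M * (-((1 - 2 * M / r p) / 2) / r p ^ 2)) / 2 * φ p
              + -(1 - 2 * M * (r p)⁻¹) / 2 * φv p) (Ici vs) p.2 :=
          ((((h1.inv hp0).const_mul (2 * M)).const_sub 1).neg.div_const 2).mul (hφv p hp')
        simp only [← div_eq_mul_inv] at hd
        refine (hd.mono Icc_subset_Ici_self).congr_deriv ?_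
        field_simp
        ring)
    have hms : MapsTo (fun u => (u, vs)) (Icc u₁ u₂) (Icc u₁ u₂ ×ˢ Ici vs) :=
      fun u hu => hmem u hu vs hvs
    have hmV : MapsTo (fun u => (u, V)) (Icc u₁ u₂) (Icc u₁ u₂ ×ˢ Ici vs) :=
      fun u hu => hmem u hu V hVm
    have hs0 : ∀ u ∈ Icc u₁ u₂, r (u, vs) ≠ 0 := fun u hu => hne _ (hmem u hu vs hvs)
    have hV0 : ∀ u ∈ Icc u₁ u₂, r (u, V) ≠ 0 := fun u hu => hne _ (hmem u hu V hVm)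
    have hs2 : ∀ u ∈ Icc u₁ u₂, 2 * r (u, vs) ^ 2 ≠ 0 := fun u hu => by simpa using hs0 u hu
    have hV3 : ∀ u ∈ Icc u₁ u₂, 2 * r (u, V) ^ 3 ≠ 0 := fun u hu => by simpa using hV0 u hu
    have hboundary := integral_eq_sub_of_hasDerivWithinAt_Icc hu.le
      (f := fun u => r (u, vs) * φ (u, vs) - 2 / M * (r (u, V) ^ 3 * φv (u, V)))
      (f' := fun u => (-(1 - 2 * M / r (u, vs)) / 2 * φ (u, vs) + r (u, vs) * φu (u, vs))
        - 2 / M * ((3 : ℕ) * r (u, V) ^ 2 * (-(1 - 2 * M / r (u, V)) / 2) * φv (u, V)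
          + r (u, V) ^ 3 * (-(M / (2 * r (u, V) ^ 3)) * (1 - 2 * M / r (u, V)) * φ (u, V))))
      (fun u hu => ((hru _ (hmem u hu vs hvs)).mul (hφu _ (hmem u hu vs hvs))).sub
        ((((hru _ (hmem u hu V hVm)).pow 3).mul (hwave _ (hmem u hu V hVm))).const_mul (2 / M)))
      (by fun_prop (disch := assumption))
    have hcone_sub : ∀ u ∈ Icc u₁ u₂,
        IntervalIntegrable (fun v => r (u, v) * φv (u, v)) volume vs V := fun u hu =>
      (((hcone u hu hrcont).mul (hcone u hu hφvcont)).mono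
        Icc_subset_Ici_self).intervalIntegrable_of_Icc hV
    rw [intervalIntegral.integral_sub (hcone_sub u₂ hu₂) (hcone_sub u₁ hu₁)] at hswap
    trans (∫ u in u₁..u₂, ((-(1 - 2 * M / r (u, vs)) / 2 * φ (u, vs) + r (u, vs) * φu (u, vs))
        - 2 / M * ((3 : ℕ) * r (u, V) ^ 2 * (-(1 - 2 * M / r (u, V)) / 2) * φv (u, V)
          + r (u, V) ^ 3 * (-(M / (2 * r (u, V) ^ 3)) * (1 - 2 * M / r (u, V)) * φ (u, V)))))
      + 2 * ∫ u in u₁..u₂, (-(1 - 2 * M / r (u, V)) / 2 * φ (u, V)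
        - -(1 - 2 * M / r (u, vs)) / 2 * φ (u, vs))
    · rw [hboundary, ← hswap]
      ring
    rw [← intervalIntegral.integral_const_mul,
      ← intervalIntegral.integral_add
        (ContinuousOn.intervalIntegrable_of_Icc hu.le (by fun_prop (disch := assumption)))
        (ContinuousOn.intervalIntegrable_of_Icc hu.le (by fun_prop (disch := assumption))),
      ← intervalIntegral.integral_add
        (ContinuousOn.intervalIntegrable_of_Icc hu.le (by fun_prop (disch := assumption)))
        (ContinuousOn.intervalIntegrable_of_Icc hu.le (by fun_prop (disch := assumption)))]
    refine intervalIntegral.integral_congr fun u hu' => ?_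
    rw [uIcc_of_le hu.le] at hu'
    have := hs0 u hu'
    have := hV0 u hu'
    field_simp
    push_cast
    ring
  have herr : Tendsto (fun V =>
      ∫ u in u₁..u₂, 3 / M * (1 - 2 * M / r (u, V)) * r (u, V) ^ 2 * φv (u, V)) atTop (𝓝 0) := by
    have hrtop := tendsto_areaRadius_atTop (R := fun v => r (u₂, v)) hM
      (fun v hv => hr _ (hmem u₂ hu₂ v hv)) (fun v hv => hrv _ (hmem u₂ hu₂ v hv))
    have h0 : Tendsto (fun V => 3 / M * C * (r (u₂, V))⁻¹ * |u₂ - u₁|) atTop (𝓝 0) := by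
      simpa using (hrtop.inv_tendsto_atTop.const_mul (3 / M * C)).mul_const |u₂ - u₁|
    refine squeeze_zero_norm' ?_ h0
    filter_upwards [eventually_ge_atTop vs] with V hV
    refine intervalIntegral.norm_integral_le_of_norm_le_const fun u hu' => ?_
    rw [uIoc_of_le hu.le] at hu'
    have hum := Ioc_subset_Icc_self hu'
    have hD0 : ∀ w ∈ Icc u₁ u₂, 0 < 1 - 2 * M / r (w, V) := fun w hw => by
      rw [sub_pos, div_lt_one (hpos _ (hmem w hw V hV))]
      exact hr _ (hmem w hw V hV)
    have hanti : AntitoneOn (fun w => r (w, V)) (Icc u₁ u₂) :=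
      antitoneOn_of_hasDerivWithinAt_nonpos (convex_Icc u₁ u₂)
        (hrcont.comp (by fun_prop) fun w hw => hmem w hw V hV)
        (fun w hw => (hru _ (hmem w (interior_subset hw) V hV)).mono interior_subset)
        fun w hw => by linarith [hD0 w (interior_subset hw)]
    have hr₂ := hpos _ (hmem u₂ hu₂ V hV)
    have hru' := hpos _ (hmem u hum V hV)
    have hle : r (u₂, V) ≤ r (u, V) := hanti hum hu₂ hum.2
    have hb := hbd _ (hmem u hum V hV)
    have hC : 0 ≤ C := le_trans (by positivity) hb
    have hD1 : 1 - 2 * M / r (u, V) ≤ 1 := by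
      have : 0 < 2 * M / r (u, V) := by positivity
      linarith
    have hDu := hD0 u hum
    calc ‖3 / M * (1 - 2 * M / r (u, V)) * r (u, V) ^ 2 * φv (u, V)‖
        = 3 / M * (1 - 2 * M / r (u, V)) * (r (u, V) ^ 3 * |φv (u, V)| * (r (u, V))⁻¹) := by
          rw [Real.norm_eq_abs, abs_mul, abs_of_pos (by positivity)]
          field_simp
      _ ≤ 3 / M * 1 * (C * (r (u₂, V))⁻¹) := by gcongr
      _ = 3 / M * C * (r (u₂, V))⁻¹ := by ring
  refine tendsto_nhds_unique (hG₂.sub hG₁) ?_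
  refine Tendsto.congr' ?_ ((add_zero (_ : ℝ)) ▸ herr.const_add (∫ u in u₁..u₂, r (u, vs) ^ 2 *
    (φu (u, vs) / r (u, vs) + φ (u, vs) * (1 - 2 * M / r (u, vs)) / (2 * r (u, vs) ^ 2))))
  filter_upwards [eventually_ge_atTop vs] with V hV
  rw [hflux u₁ hu₁ V hV, hflux u₂ hu₂ V hV, hbalance V hV]
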